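/- arXiv:1208.0283 — 2 statements merged into one kernel-verified Lean document; each statement's English description precedes it below -/
import Mathlib

section
/- Identify V with {1, …, n}. Let λ > 0, λ ≠ 1. Suppose r is a fractional assignment for the weighted graph (G, w) whose induced vector z satisfies z_1 ≥ z_2 ≥ … ≥ z_n, and suppose z minimizes the Rényi entropy H_λ(z/W) over all vectors induced by fractional assignments. Then for every edge {i,j} ∈ E with i < j and w_{{i,j}} > 0, one has r_{i,j} = 1 (and hence r_{j,i} = 0). -/
/-- Spreading two points apart strictly increases the sum of the values of a strictly convex
function. -/
theorem StrictConvexOn.add_lt_add_of_spread {s : Set ℝ} {f : ℝ → ℝ} (hf : StrictConvexOn ℝ s f)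
    {a b d : ℝ} (hba : b ≤ a) (hd : 0 < d) (hb : b - d ∈ s) (ha : a + d ∈ s) :
    f a + f b < f (a + d) + f (b - d) := by
  have hD : 0 < a - b + 2 * d := by linarith
  have hne : b - d ≠ a + d := by linarith
  set t := d / (a - b + 2 * d) with ht
  have ht0 : 0 < t := by positivity
  have ht1 : 0 < 1 - t := by
    rw [ht, sub_pos, div_lt_one hD]
    linarith
  have htD : t * (a - b + 2 * d) = d := div_mul_cancel₀ _ hD.ne'
  have h₁ := hf.2 hb ha hne ht0 ht1 (by ring)
  have h₂ := hf.2 hb ha hne ht1 ht0 (by ring)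
  simp only [smul_eq_mul] at h₁ h₂
  rw [show t * (b - d) + (1 - t) * (a + d) = a by linear_combination -htD] at h₁
  rw [show (1 - t) * (b - d) + t * (a + d) = b by linear_combination htD] at h₂
  linarith

/-- Spreading two points apart strictly decreases the sum of the values of a strictly concave
function. -/
theorem StrictConcaveOn.add_lt_add_of_spread {s : Set ℝ} {f : ℝ → ℝ} (hf : StrictConcaveOn ℝ s f)
    {a b d : ℝ} (hba : b ≤ a) (hd : 0 < d) (hb : b - d ∈ s) (ha : a + d ∈ s) :
    f (a + d) + f (b - d) < f a + f b := by
  have h := hf.neg.add_lt_add_of_spread hba hd hb ha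
  simp only [Pi.neg_apply] at h
  linarith


/-- If a fractional assignment `r` induces a nonincreasingly sorted vector `z`
of minimum Rényi entropy among all fractional assignments, then every edge
`{i,j}` with `i < j` and positive weight satisfies `r i j = 1` (and `r j i = 0`). -/
theorem optimal_fractional_assignment_structure
    (n : ℕ) (G : SimpleGraph (Fin n)) [DecidableRel G.Adj]
    (w : Fin n → Fin n → ℝ) (hsym : ∀ i j, w i j = w j i)
    (hnn : ∀ i j, 0 ≤ w i j) (hsupp : ∀ i j, ¬ G.Adj i j → w i j = 0)
    (W : ℝ) (hW : W = (∑ i, ∑ j, w i j) / 2) (hWpos : 0 < W)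
    (lam : ℝ) (hlam0 : 0 < lam) (hlam1 : lam ≠ 1)
    (r : Fin n → Fin n → ℝ)
    (hr0 : ∀ i j, G.Adj i j → 0 ≤ r i j)
    (hr1 : ∀ i j, G.Adj i j → r i j + r j i = 1)
    (z : Fin n → ℝ)
    (hz : ∀ i, z i = ∑ j ∈ Finset.univ.filter (fun j => G.Adj i j), r i j * w i j)
    (hsorted : ∀ i j : Fin n, i ≤ j → z j ≤ z i)
    (hopt : ∀ r' : Fin n → Fin n → ℝ,
      (∀ i j, G.Adj i j → 0 ≤ r' i j) →
      (∀ i j, G.Adj i j → r' i j + r' j i = 1) →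
      (1 / (1 - lam)) * Real.logb 2 (∑ i, (z i / W) ^ lam) ≤
        (1 / (1 - lam)) * Real.logb 2
          (∑ i, ((∑ j ∈ Finset.univ.filter (fun j => G.Adj i j),
            r' i j * w i j) / W) ^ lam)) :
    ∀ i j : Fin n, G.Adj i j → i < j → 0 < w i j → r i j = 1 ∧ r j i = 0 := by
  intro i j hij hlt hw
  have hji := hij.symm
  have hne : i ≠ j := hlt.ne
  suffices h : r j i = 0 by
    refine ⟨?_, h⟩
    have := hr1 i j hij
    linarith
  by_contra h_ne
  have hd : 0 < r j i * w i j := mul_pos (lt_of_le_of_ne (hr0 j i hji) (Ne.symm h_ne)) hw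
  set d := r j i * w i j with hd_def
  set r' : Fin n → Fin n → ℝ := fun a b =>
    if a = i ∧ b = j then 1 else if a = j ∧ b = i then 0 else r a b with hr'
  have hr'0 : ∀ a b, G.Adj a b → 0 ≤ r' a b := by
    intro a b hab
    have := hr0 a b hab
    simp only [hr']
    split_ifs <;> linarith
  have hr'1 : ∀ a b, G.Adj a b → r' a b + r' b a = 1 := by
    intro a b hab
    have := hr1 a b hab
    simp only [hr']
    grind
  set z' : Fin n → ℝ := fun k => ∑ l ∈ Finset.univ.filter (fun l => G.Adj k l), r' k l * w k l
    with hz'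
  have hdiff : ∀ k, z' k - z k =
      ∑ l ∈ Finset.univ.filter (fun l => G.Adj k l), (r' k l - r k l) * w k l := by
    intro k
    simp only [hz', hz, ← Finset.sum_sub_distrib, sub_mul]
  have hzi : z' i = z i + d := by
    have h := hdiff i
    rw [Finset.sum_eq_single j] at h
    · have hone := hr1 i j hij
      simp only [hr', true_and, if_true] at h
      rw [hd_def]
      linear_combination h - w i j * hone
    · intro l _ hl
      simp [hr', hl, hne]
    · simp [hij]
  have hzj : z' j = z j - d := by
    have h := hdiff j
    rw [Finset.sum_eq_single i] at h
    · simp only [hr', hne, hne.symm, and_self, if_true, if_false, hsym j i] at h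
      rw [hd_def]
      linear_combination h
    · intro l _ hl
      simp [hr', hl, hne.symm]
    · simp [hji]
  have hzk : ∀ k, k ≠ i → k ≠ j → z' k = z k := by
    intro k hki hkj
    simp [hz', hz, hr', hki, hkj]
  have hz0 : ∀ k, 0 ≤ z k := by
    intro k
    rw [hz]
    exact Finset.sum_nonneg fun l hl =>
      mul_nonneg (hr0 k l (Finset.mem_filter.mp hl).2) (hnn k l)
  have hz'0 : ∀ k, 0 ≤ z' k := fun k => Finset.sum_nonneg fun l hl =>
    mul_nonneg (hr'0 k l (Finset.mem_filter.mp hl).2) (hnn k l)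
  have hzji : z j ≤ z i := hsorted i j hlt.le
  have hzj0 : 0 ≤ z j - d := hzj ▸ hz'0 j
  have hsum : ∑ k, (z' k / W) ^ lam - ∑ k, (z k / W) ^ lam =
      ((z i / W + d / W) ^ lam + (z j / W - d / W) ^ lam)
        - ((z i / W) ^ lam + (z j / W) ^ lam) := by
    rw [← Finset.sum_sub_distrib, Finset.sum_eq_add i j hne]
    · rw [hzi, hzj, add_div, sub_div]
      ring
    · intro k _ hk
      rw [hzk k hk.1 hk.2, sub_self]
    · simp
    · simp
  have hpos : ∀ y : Fin n → ℝ, (∀ k, 0 ≤ y k) → 0 < y i → 0 < ∑ k, (y k / W) ^ lam :=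
    fun y hy hyi => Finset.sum_pos'
      (fun k _ => Real.rpow_nonneg (div_nonneg (hy k) hWpos.le) _)
      ⟨i, Finset.mem_univ i, Real.rpow_pos_of_pos (div_pos hyi hWpos) _⟩
  have hS : 0 < ∑ k, (z k / W) ^ lam := hpos z hz0 (by linarith)
  have hS' : 0 < ∑ k, (z' k / W) ^ lam := hpos z' hz'0 (by linarith)
  have hle : z j / W ≤ z i / W := div_le_div_of_nonneg_right hzji hWpos.le
  have hdW : 0 < d / W := div_pos hd hWpos
  have hlow : z j / W - d / W ∈ Set.Ici (0 : ℝ) := by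
    rw [Set.mem_Ici, ← sub_div]
    exact div_nonneg hzj0 hWpos.le
  have hhigh : z i / W + d / W ∈ Set.Ici (0 : ℝ) :=
    add_nonneg (div_nonneg (hz0 i) hWpos.le) hdW.le
  have hmin := hopt r' hr'0 hr'1
  change _ ≤ 1 / (1 - lam) * Real.logb 2 (∑ k, (z' k / W) ^ lam) at hmin
  rcases lt_or_gt_of_ne hlam1 with hl | hl
  · have h := (Real.strictConcaveOn_rpow hlam0 hl).add_lt_add_of_spread hle hdW hlow hhigh
    have hlog := Real.logb_lt_logb one_lt_two hS'
      (show ∑ k, (z' k / W) ^ lam < ∑ k, (z k / W) ^ lam by linarith)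
    exact absurd hmin (not_le.mpr (mul_lt_mul_of_pos_left hlog
      (one_div_pos.mpr (sub_pos.mpr hl))))
  · have h := (strictConvexOn_rpow hl).add_lt_add_of_spread hle hdW hlow hhigh
    have hlog := Real.logb_lt_logb one_lt_two hS
      (show ∑ k, (z k / W) ^ lam < ∑ k, (z' k / W) ^ lam by linarith)
    exact absurd hmin (not_le.mpr (mul_lt_mul_of_neg_left hlog
      (one_div_neg.mpr (sub_neg.mpr hl))))
end

section
/- Let G be a finite loopless undirected graph on vertices v_1, …, v_n with nonnegative integer edge weights w and total weight W > 0, where the ordering v_1, …, v_n is greedy, and let Δ be the associated greedy cover (so Σ_r Δ_r = W). Then for every integer cover x of (G, w), the Shannon entropies satisfy H(Δ/W) ≤ H(x/W) + log₂(e). -/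
/-- Discrete derivative bound for `t ↦ t log t - t`. -/
theorem succ_mul_log_sub_le (k : ℕ) :
    ((k + 1 : ℕ) : ℝ) * Real.log ((k + 1 : ℕ) : ℝ) - ((k + 1 : ℕ) : ℝ) ≤
      Real.log ((k + 1 : ℕ) : ℝ) + ((k : ℝ) * Real.log k - k) := by
  rcases Nat.eq_zero_or_pos k with rfl | hk
  · simp
  · have hk' : (0 : ℝ) < k := by exact_mod_cast hk
    have h := Real.log_le_sub_one_of_pos (x := ((k : ℝ) + 1) / k) (by positivity)
    rw [Real.log_div (by positivity) (by positivity)] at h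
    have h2 := mul_le_mul_of_nonneg_left h hk'.le
    have h3 : (k : ℝ) * (((k : ℝ) + 1) / k - 1) = 1 := by field_simp; ring
    push_cast
    nlinarith

/-- Summing the logarithms of the sizes of the upper sets `{e' ∈ F | τ e ≤ τ e'}` over `e ∈ F`
gives at least `|F| log |F| - |F|`. -/
theorem card_mul_log_sub_le_sum_log_card {E α : Type*} [DecidableEq E] [LinearOrder α]
    (τ : E → α) (F : Finset E) :
    (F.card : ℝ) * Real.log F.card - F.card ≤
      ∑ e ∈ F, Real.log ((F.filter (fun e' => τ e ≤ τ e')).card : ℝ) := by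
  induction F using Finset.induction_on_min_value τ with
  | empty => simp
  | insert a s ha hmin ih =>
    rw [Finset.sum_insert ha]
    have h1 : (insert a s).filter (fun e' => τ a ≤ τ e') = insert a s := by
      apply Finset.filter_true_of_mem
      intro e he
      rcases Finset.mem_insert.1 he with rfl | he
      · exact le_rfl
      · exact hmin e he
    have h2 : ∑ e ∈ s, Real.log ((s.filter (fun e' => τ e ≤ τ e')).card : ℝ) ≤
        ∑ e ∈ s, Real.log (((insert a s).filter (fun e' => τ e ≤ τ e')).card : ℝ) := by
      refine Finset.sum_le_sum fun e he => Real.log_le_log ?_ ?_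
      · exact_mod_cast Finset.card_pos.2 ⟨e, by simp [he]⟩
      · exact_mod_cast Finset.card_le_card
          (Finset.filter_subset_filter _ (Finset.subset_insert a s))
    rw [h1, Finset.card_insert_of_notMem ha]
    linarith [succ_mul_log_sub_le s.card]

/-- The unit-weight edges of a weighted graph: `w i j` parallel copies of each pair `i < j`. -/
abbrev UnitEdge {n : ℕ} (w : Fin n → Fin n → ℕ) : Type :=
  Σ i : Fin n, Σ j : Fin n, Fin (if i < j then w i j else 0)

namespace UnitEdge

variable {n : ℕ} {w : Fin n → Fin n → ℕ}

theorem fst_lt_snd (e : UnitEdge w) : e.1 < e.2.1 := by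
  obtain ⟨i, j, c⟩ := e
  by_contra h
  exact Nat.not_lt_zero c.1 (c.2.trans_eq (if_neg h))

theorem card_eq : Fintype.card (UnitEdge w) =
    ∑ i, ∑ j ∈ Finset.univ.filter (fun j => i < j), w i j := by
  simp [UnitEdge, Finset.sum_filter]

theorem card_filter_le (a b : Fin n) :
    (Finset.univ.filter (fun e : UnitEdge w => e.1 = a ∧ e.2.1 = b)).card ≤ w a b := by
  have hsub : Finset.univ.filter (fun e : UnitEdge w => e.1 = a ∧ e.2.1 = b) ⊆
      Finset.univ.image
        (fun c : Fin (if a < b then w a b else 0) => (⟨a, b, c⟩ : UnitEdge w)) := by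
    rintro ⟨i, j, c⟩ h
    obtain ⟨rfl, rfl⟩ : i = a ∧ j = b := by simpa using h
    simp
  refine (Finset.card_le_card hsub).trans (Finset.card_image_le.trans ?_)
  rw [Finset.card_univ, Fintype.card_fin]
  split_ifs <;> simp

/-- The unit edges at `j` whose endpoints are all at least `r` are counted by the weighted degree
of `j` in the subgraph induced by the vertices from `r` on. -/
theorem card_incident_le (hsym : ∀ i j, w i j = w j i) (r j : Fin n) :
    (Finset.univ.filter (fun e : UnitEdge w => (j = e.1 ∨ j = e.2.1) ∧ r ≤ e.1)).card ≤
      ∑ t ∈ Finset.univ.filter (fun t => r ≤ t ∧ t ≠ j), w j t := by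
  rw [Finset.card_eq_sum_card_fiberwise
    (f := fun e : UnitEdge w => if j = e.1 then e.2.1 else e.1)
    (t := Finset.univ.filter (fun t => r ≤ t ∧ t ≠ j))]
  · refine Finset.sum_le_sum fun t _ => ?_
    rcases le_or_gt j t with hjt | hjt
    · refine (Finset.card_le_card ?_).trans (card_filter_le j t)
      intro e he
      have := e.fst_lt_snd
      simp only [Finset.mem_filter, Finset.mem_univ, true_and] at he ⊢
      grind
    · rw [hsym]
      refine (Finset.card_le_card ?_).trans (card_filter_le t j)
      intro e he
      have := e.fst_lt_snd
      simp only [Finset.mem_filter, Finset.mem_univ, true_and] at he ⊢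
      grind
  · intro e he
    have := e.fst_lt_snd
    simp only [Finset.coe_filter, Finset.mem_univ, true_and, Set.mem_ofPred_eq] at he ⊢
    grind

/-- Every integer cover comes from assigning each unit edge to one of its endpoints. -/
theorem exists_assignment (x : Fin n → ℕ) (hxsum : ∑ i, x i = Fintype.card (UnitEdge w))
    (hxcover : ∀ S : Finset (Fin n),
      ∑ i ∈ S, ∑ j ∈ S.filter (fun j => i < j), w i j ≤ ∑ i ∈ S, x i) :
    ∃ o : UnitEdge w → Fin n, (∀ e, o e = e.1 ∨ o e = e.2.1) ∧
      ∀ j, (Finset.univ.filter (fun e => o e = j)).card = x j := by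
  classical
  let N : UnitEdge w → Finset (Σ i, Fin (x i)) :=
    fun e => Finset.univ.filter (fun s => s.1 = e.1 ∨ s.1 = e.2.1)
  have hall : ∀ F : Finset (UnitEdge w), F.card ≤ (F.biUnion N).card := by
    intro F
    let S : Finset (Fin n) := F.image (fun e => e.1) ∪ F.image (fun e => e.2.1)
    have h1 : F ⊆ S.sigma (fun i => S.sigma
        (fun j => (Finset.univ : Finset (Fin (if i < j then w i j else 0))))) := by
      intro e he
      simp only [Finset.mem_sigma, Finset.mem_univ, and_true, S, Finset.mem_union]
      exact ⟨Or.inl (Finset.mem_image_of_mem _ he),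
        Or.inr (Finset.mem_image_of_mem (fun e : UnitEdge w => e.2.1) he)⟩
    have h2 : S.sigma (fun i => (Finset.univ : Finset (Fin (x i)))) ⊆ F.biUnion N := by
      intro s hs
      simp only [Finset.mem_sigma, Finset.mem_univ, and_true, S, Finset.mem_union,
        Finset.mem_image] at hs
      simp only [Finset.mem_biUnion, N, Finset.mem_filter, Finset.mem_univ, true_and]
      rcases hs with ⟨e, he, h⟩ | ⟨e, he, h⟩
      · exact ⟨e, he, Or.inl h.symm⟩
      · exact ⟨e, he, Or.inr h.symm⟩
    have h3 := Finset.card_le_card h1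
    have h4 := Finset.card_le_card h2
    have h5 := hxcover S
    simp only [Finset.card_sigma, Finset.card_univ, Fintype.card_fin] at h3 h4
    simp only [Finset.sum_filter] at h5
    omega
  obtain ⟨f, hinj, hmem⟩ := (Finset.all_card_le_biUnion_card_iff_exists_injective N).1 hall
  have hbij : Function.Bijective f :=
    (Fintype.bijective_iff_injective_and_card f).2 ⟨hinj, by simp [← hxsum]⟩
  refine ⟨fun e => (f e).1, fun e => by simpa [N] using hmem e, fun j => ?_⟩
  have h1 : (Finset.univ.filter (fun e => (f e).1 = j)).card =
      (Finset.univ.filter (fun s : Σ i, Fin (x i) => s.1 = j)).card :=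
    Finset.card_bijective f hbij (by simp)
  have h2 : Finset.univ.filter (fun s : Σ i, Fin (x i) => s.1 = j) =
      ({j} : Finset (Fin n)).sigma (fun i => (Finset.univ : Finset (Fin (x i)))) := by
    ext s
    simp
  rw [h1, h2, Finset.card_sigma]
  simp

theorem sum_fst (g : Fin n → ℝ) : ∑ e : UnitEdge w, g e.1 =
    ∑ r, ((∑ t ∈ Finset.univ.filter (fun t => r < t), w r t : ℕ) : ℝ) * g r := by
  simp [UnitEdge, Fintype.sum_sigma, Finset.sum_filter, Finset.sum_mul]

end UnitEdge

/-- The entropy of `y / W`, for `y` of total `W`, in terms of `∑ y log y`. -/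
theorem sum_div_mul_logb_div {ι : Type*} [Fintype ι] (y : ι → ℕ) (W : ℕ) (hW : 0 < W)
    (hy : ∑ i, y i = W) :
    ∑ i, ((y i : ℝ) / W) * Real.logb 2 ((y i : ℝ) / W) =
      ((∑ i, (y i : ℝ) * Real.log (y i)) / W - Real.log W) / Real.log 2 := by
  have hW' : (W : ℝ) ≠ 0 := by exact_mod_cast hW.ne'
  have h : ∀ i, ((y i : ℝ) / W) * Real.logb 2 ((y i : ℝ) / W) =
      ((y i : ℝ) * Real.log (y i)) / W / Real.log 2 -
        (y i : ℝ) * (Real.log W / W / Real.log 2) := by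
    intro i
    rcases Nat.eq_zero_or_pos (y i) with h0 | h0
    · simp [h0]
    · rw [Real.logb, Real.log_div (by positivity) hW']
      ring
  rw [Finset.sum_congr rfl fun i _ => h i, Finset.sum_sub_distrib, ← Finset.sum_mul,
    ← Finset.sum_div, ← Finset.sum_div, ← Nat.cast_sum, hy]
  field_simp

/-- Additive Shannon-entropy guarantee of the greedy cover for induced subgraph
games: `H(Δ/W) ≤ H(x/W) + log₂ e` for every integer cover `x`. -/
theorem greedy_cover_shannon_bound
    (n : ℕ) (w : Fin n → Fin n → ℕ)
    (hsym : ∀ i j, w i j = w j i) (hloop : ∀ i, w i i = 0)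
    (W : ℕ)
    (hW : W = ∑ i, ∑ j ∈ Finset.univ.filter (fun j => i < j), w i j)
    (hWpos : 0 < W)
    (hgreedy : ∀ r s : Fin n, r < s →
      ∑ t ∈ Finset.univ.filter (fun t => r ≤ t ∧ t ≠ s), w s t ≤
        ∑ t ∈ Finset.univ.filter (fun t => r < t), w r t)
    (Δ : Fin n → ℕ)
    (hΔ : ∀ r, Δ r = ∑ t ∈ Finset.univ.filter (fun t => r < t), w r t)
    (x : Fin n → ℕ) (hxsum : ∑ i, x i = W)
    (hxcover : ∀ S : Finset (Fin n),
      ∑ i ∈ S, ∑ j ∈ S.filter (fun j => i < j), w i j ≤ ∑ i ∈ S, x i) :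
    -(∑ r, ((Δ r : ℝ) / (W : ℝ)) * Real.logb 2 ((Δ r : ℝ) / (W : ℝ))) ≤
      -(∑ j, ((x j : ℝ) / (W : ℝ)) * Real.logb 2 ((x j : ℝ) / (W : ℝ)))
        + Real.logb 2 (Real.exp 1) := by
  have hcard : Fintype.card (UnitEdge w) = W := by rw [UnitEdge.card_eq, hW]
  have hΔsum : ∑ r, Δ r = W := by simp only [hΔ, hW]
  obtain ⟨o, ho, hox⟩ := UnitEdge.exists_assignment (w := w) x (hxsum.trans hcard.symm) hxcover
  have hvertex : ∀ j, (x j : ℝ) * Real.log (x j) - x j ≤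
      ∑ e ∈ Finset.univ.filter (fun e : UnitEdge w => o e = j), Real.log (Δ e.1) := by
    intro j
    have h := card_mul_log_sub_le_sum_log_card (fun e : UnitEdge w => e.1)
      (Finset.univ.filter (fun e : UnitEdge w => o e = j))
    rw [hox] at h
    refine h.trans (Finset.sum_le_sum fun e he => Real.log_le_log ?_ ?_)
    · exact_mod_cast Finset.card_pos.2 ⟨e, by simpa using he⟩
    · have hej : o e = j := by simpa using he
      have hle : e.1 ≤ j := by
        rcases ho e with h | h
        · exact (h.symm.trans hej).le
        · exact e.fst_lt_snd.le.trans (h.symm.trans hej).le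
      have hdeg : ∑ t ∈ Finset.univ.filter (fun t => e.1 ≤ t ∧ t ≠ j), w j t ≤ Δ e.1 := by
        rw [hΔ]
        rcases hle.lt_or_eq with hlt | heq
        · exact hgreedy _ _ hlt
        · rw [← heq]
          refine le_of_eq (Finset.sum_congr (Finset.filter_congr fun t _ => ?_) fun _ _ => rfl)
          rw [lt_iff_le_and_ne, ne_comm]
      refine Nat.cast_le.2 (le_trans (Finset.card_le_card ?_)
        ((UnitEdge.card_incident_le hsym e.1 j).trans hdeg))
      intro e' he'
      simp only [Finset.mem_filter, Finset.mem_univ, true_and] at he' ⊢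
      exact ⟨he'.1 ▸ ho e', he'.2⟩
  have hmain : ∑ j, (x j : ℝ) * Real.log (x j) - W ≤ ∑ r, (Δ r : ℝ) * Real.log (Δ r) := by
    have h := Finset.sum_le_sum fun j (_ : j ∈ Finset.univ) => hvertex j
    rw [Finset.sum_fiberwise, UnitEdge.sum_fst (fun r => Real.log (Δ r)),
      Finset.sum_sub_distrib, ← Nat.cast_sum, hxsum] at h
    simpa only [← hΔ] using h
  have hW' : (0 : ℝ) < W := by exact_mod_cast hWpos
  have hlog2 : 0 < Real.log 2 := Real.log_pos one_lt_two
  rw [sum_div_mul_logb_div Δ W hWpos hΔsum, sum_div_mul_logb_div x W hWpos hxsum, Real.logb,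
    Real.log_exp, ← neg_div, ← neg_div, ← add_div]
  refine div_le_div_of_nonneg_right ?_ hlog2.le
  have h := div_le_div_of_nonneg_right hmain hW'.le
  rw [sub_div, div_self hW'.ne'] at h
  linarith
end
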